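/- arXiv:1902.09877 — 6 statements merged into one kernel-verified Lean document; each statement's English description precedes it below -/
import Mathlib

section
/- For every natural number N ≥ 1 and every N-element point set P in [0,1], and for every α > 0, the Lebesgue measure of {t ∈ [0,1] : |D_P(t)| < α} is at most the Lebesgue measure of {t ∈ [0,1] : |D_{Γ_N}(t)| < α}, where Γ_N is the centered regular grid. -/
open MeasureTheory Set

/-- One-parameter discrepancy function of the point set `x₀, …, x_{N-1}`. -/
noncomputable def disc (N : ℕ) (x : Fin N → ℝ) (t : ℝ) : ℝ :=
  (∑ n : Fin N, (Set.Ico (0:ℝ) t).indicator (fun _ => (1:ℝ)) (x n)) - N * t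

/-- The centered regular grid Γ_N. -/
noncomputable def grid (N : ℕ) : Fin N → ℝ := fun n => (2 * (n : ℝ) + 1) / (2 * N)

theorem exists_natCast_disc_eq (N : ℕ) (x : Fin N → ℝ) (t : ℝ) :
    ∃ k : ℕ, disc N x t = k - N * t := by
  classical
  refine ⟨(Finset.univ.filter fun n => x n ∈ Ico (0 : ℝ) t).card, ?_⟩
  simp [disc, indicator_apply]

theorem disc_grid {N : ℕ} (hN : 1 ≤ N) {t : ℝ} (ht : t ≤ 1) :
    disc N (grid N) t = ⌈N * t - 1 / 2⌉₊ - N * t := by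
  have hN' : (0 : ℝ) < N := by exact_mod_cast hN
  have hc : ⌈(N : ℝ) * t - 1 / 2⌉₊ ≤ N := Nat.ceil_le.2 (by nlinarith)
  have hmem (n : ℕ) :
      (2 * (n : ℝ) + 1) / (2 * N) ∈ Ico (0 : ℝ) t ↔ n < ⌈(N : ℝ) * t - 1 / 2⌉₊ := by
    rw [Nat.lt_ceil, mem_Ico, and_iff_right (by positivity), div_lt_iff₀ (by positivity)]
    constructor <;> intro h <;> linarith
  have hfilter : (Finset.range N).filter (fun n => n < ⌈(N : ℝ) * t - 1 / 2⌉₊) =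
      Finset.range ⌈(N : ℝ) * t - 1 / 2⌉₊ := by
    ext n
    simp only [Finset.mem_filter, Finset.mem_range]
    omega
  unfold disc grid
  simp only [indicator_apply, hmem]
  rw [Fin.sum_univ_eq_sum_range
    (fun n => if n < ⌈(N : ℝ) * t - 1 / 2⌉₊ then (1 : ℝ) else 0) N, Finset.sum_boole, hfilter,
    Finset.card_range]

theorem abs_natCeil_sub_half_sub_le {y : ℝ} (hy : 0 ≤ y) (k : ℕ) :
    |(⌈y - 1 / 2⌉₊ : ℝ) - y| ≤ |(k : ℝ) - y| := by
  have hlo : y - 1 / 2 ≤ ⌈y - 1 / 2⌉₊ := Nat.le_ceil _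
  have hhi : (⌈y - 1 / 2⌉₊ : ℝ) ≤ y + 1 / 2 := by
    rcases le_total 0 (y - 1 / 2) with h | h
    · linarith [Nat.ceil_lt_add_one h]
    · rw [Nat.ceil_eq_zero.2 h, Nat.cast_zero]
      linarith
  rcases lt_trichotomy k ⌈y - 1 / 2⌉₊ with h | h | h
  · have h' : (k : ℝ) + 1 ≤ ⌈y - 1 / 2⌉₊ := by exact_mod_cast h
    rw [abs_le]
    constructor <;> linarith [neg_abs_le ((k : ℝ) - y)]
  · rw [← h]
  · have h' : (⌈y - 1 / 2⌉₊ : ℝ) + 1 ≤ k := by exact_mod_cast h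
    rw [abs_le]
    constructor <;> linarith [le_abs_self ((k : ℝ) - y)]

/-- At every point, the centered regular grid minimizes the absolute discrepancy. -/
theorem abs_disc_grid_le {N : ℕ} (hN : 1 ≤ N) (x : Fin N → ℝ) {t : ℝ} (ht : t ∈ Icc (0 : ℝ) 1) :
    |disc N (grid N) t| ≤ |disc N x t| := by
  obtain ⟨k, hk⟩ := exists_natCast_disc_eq N x t
  rw [disc_grid hN ht.2, hk]
  exact abs_natCeil_sub_half_sub_le (mul_nonneg N.cast_nonneg ht.1) k

theorem extremal_distribution_one_param (N : ℕ) (hN : 1 ≤ N)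
    (x : Fin N → ℝ) (hx : ∀ n, x n ∈ Set.Icc (0:ℝ) 1) (α : ℝ) (hα : 0 < α) :
    volume {t ∈ Set.Icc (0:ℝ) 1 | |disc N x t| < α} ≤
      volume {t ∈ Set.Icc (0:ℝ) 1 | |disc N (grid N) t| < α} := by
  exact measure_mono fun t ht => ⟨ht.1, (abs_disc_grid_le hN x ht.1).trans_lt ht.2⟩
end

section
/- Let P = {x_0 ≤ x_1 ≤ ... ≤ x_{N-1}} ⊂ [0,1] be an N-element point set and set x_{−1} = 0, x_N = 1. Then the pushforward of Lebesgue measure on [0,1] under the map t ↦ D_P(t) has density g = (1/N) Σ_{n=0}^{N} 1_{I_n} with respect to Lebesgue measure on ℝ, where I_n = (n − N x_n, n − N x_{n−1}); that is, for all a < b, the Lebesgue measure of {t ∈ [0,1] : D_P(t) ∈ (a,b)} equals ∫_a^b g(t) dt. -/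
open MeasureTheory Set

/-- The extended points: `xe n = x_n` for `0 ≤ n ≤ N-1` and `xe N = 1`. -/
noncomputable def xe (N : ℕ) (x : Fin N → ℝ) (n : ℕ) : ℝ :=
  if h : n < N then x ⟨n, h⟩ else 1

/-- The shifted extended points: `xprev n = x_{n-1}`, with `x_{-1} = 0`. -/
noncomputable def xprev (N : ℕ) (x : Fin N → ℝ) (n : ℕ) : ℝ :=
  if n = 0 then 0 else xe N x (n - 1)

/-- The density of the pushforward of Lebesgue measure under `D_P`:
`g = (1/N) Σ_{n=0}^{N} 1_{I_n}` with `I_n = (n − N x_n, n − N x_{n−1})`. -/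
noncomputable def discDensity (N : ℕ) (x : Fin N → ℝ) (t : ℝ) : ℝ :=
  (1 / (N : ℝ)) * ∑ n ∈ Finset.range (N + 1),
    (Set.Ioo ((n : ℝ) - N * xe N x n) ((n : ℝ) - N * xprev N x n)).indicator
      (fun _ => (1:ℝ)) t

lemma xe_of_lt {N : ℕ} (x : Fin N → ℝ) {n : ℕ} (h : n < N) : xe N x n = x ⟨n, h⟩ := dif_pos h

lemma xe_of_le {N : ℕ} (x : Fin N → ℝ) {n : ℕ} (h : N ≤ n) : xe N x n = 1 := dif_neg h.not_gt

lemma xprev_zero (N : ℕ) (x : Fin N → ℝ) : xprev N x 0 = 0 := if_pos rfl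

lemma xprev_succ (N : ℕ) (x : Fin N → ℝ) (n : ℕ) : xprev N x (n + 1) = xe N x n := by
  simp [xprev]

lemma xe_monotone {N : ℕ} {x : Fin N → ℝ} (hx : ∀ n, x n ∈ Icc (0:ℝ) 1) (hmono : Monotone x) :
    Monotone (xe N x) := by
  intro m n hmn
  rcases lt_or_ge n N with hn | hn
  · rw [xe_of_lt x hn, xe_of_lt x (hmn.trans_lt hn)]
    exact hmono hmn
  · rw [xe_of_le x hn]
    rcases lt_or_ge m N with hm | hm
    · rw [xe_of_lt x hm]
      exact (hx _).2
    · rw [xe_of_le x hm]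

lemma xprev_monotone {N : ℕ} {x : Fin N → ℝ} (hx : ∀ n, x n ∈ Icc (0:ℝ) 1)
    (hmono : Monotone x) : Monotone (xprev N x) := by
  refine monotone_nat_of_le_succ fun n => ?_
  rcases n with _ | n
  · rw [xprev_zero, xprev_succ]
    rcases lt_or_ge 0 N with hN | hN
    · rw [xe_of_lt x hN]
      exact (hx _).1
    · rw [xe_of_le x hN]
      exact zero_le_one
  · rw [xprev_succ, xprev_succ]
    exact xe_monotone hx hmono n.le_succ

/-- The discrepancy function is affine between consecutive points. -/
lemma disc_eq_of_mem_Ioc {N : ℕ} {x : Fin N → ℝ} (hx : ∀ n, x n ∈ Icc (0:ℝ) 1)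
    (hmono : Monotone x) {n : ℕ} (hn : n ≤ N) {t : ℝ}
    (ht : t ∈ Ioc (xprev N x n) (xprev N x (n + 1))) : disc N x t = n - N * t := by
  have key (i : Fin N) : (Ico (0:ℝ) t).indicator (fun _ => (1:ℝ)) (x i) =
      if (i : ℕ) < n then 1 else 0 := by
    have hi : xprev N x (i + 1) = x i := by rw [xprev_succ, xe_of_lt x i.2]
    split_ifs with h
    · refine indicator_of_mem (mem_Ico.2 ⟨(hx i).1, ?_⟩) _
      rw [← hi]
      exact (xprev_monotone hx hmono h).trans_lt ht.1
    · refine indicator_of_notMem (fun h' => h'.2.not_ge ?_) _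
      rw [← hi]
      exact ht.2.trans (xprev_monotone hx hmono (by omega))
  have hfilter : (Finset.range N).filter (· < n) = Finset.range n := by
    ext i
    simp only [Finset.mem_filter, Finset.mem_range]
    omega
  rw [disc, Finset.sum_congr rfl fun i _ => key i,
    Fin.sum_univ_eq_sum_range (fun i => if i < n then (1:ℝ) else 0), Finset.sum_boole, hfilter,
    Finset.card_range]

lemma intervalIntegral_indicator_Ioo_one {a b : ℝ} (hab : a ≤ b) (p q : ℝ) :
    ∫ t in a..b, (Ioo p q).indicator (fun _ => (1:ℝ)) t = max (min q b - max p a) 0 := by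
  rw [intervalIntegral.integral_of_le hab, ← Pi.one_def, integral_indicator_one measurableSet_Ioo,
    measureReal_restrict_apply measurableSet_Ioo,
    measureReal_congr (Ioo_ae_eq_Ioc.inter (ae_eq_refl (Ioc a b))), Ioc_inter_Ioc, Real.volume_real_Ioc]

lemma intervalIntegral_discDensity {a b : ℝ} (hab : a ≤ b) (N : ℕ) (x : Fin N → ℝ) :
    ∫ t in a..b, discDensity N x t = (1 / (N : ℝ)) * ∑ n ∈ Finset.range (N + 1),
      max (min ((n : ℝ) - N * xprev N x n) b - max ((n : ℝ) - N * xe N x n) a) 0 := by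
  simp only [discDensity]
  rw [intervalIntegral.integral_const_mul, intervalIntegral.integral_finsetSum]
  · simp only [intervalIntegral_indicator_Ioo_one hab]
  · intro n _
    rw [intervalIntegrable_iff]
    exact (integrableOn_const (by simp)).indicator measurableSet_Ioo

/-- The measure of the part of `(u, v]` mapped into `(a, b)` by `t ↦ d - c * t`. -/
lemma volume_Ioc_inter_affine_preimage {c : ℝ} (hc : 0 < c) (d u v a b : ℝ) :
    volume (Ioc u v ∩ {t | d - c * t ∈ Ioo a b}) =
      ENNReal.ofReal ((1 / c) * max (min (d - c * u) b - max (d - c * v) a) 0) := by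
  have hset : {t | d - c * t ∈ Ioo a b} = Ioo ((d - b) / c) ((d - a) / c) := by
    ext t
    simp only [mem_ofPred_eq, mem_Ioo, div_lt_iff₀ hc, lt_div_iff₀ hc]
    constructor <;> rintro ⟨h₁, h₂⟩ <;> constructor <;> linarith
  have hmin : c * min v ((d - a) / c) = d - max (d - c * v) a := by
    rw [mul_min_of_nonneg _ _ hc.le, mul_div_cancel₀ _ hc.ne', max_def, min_def]
    split_ifs <;> linarith
  have hmax : c * max u ((d - b) / c) = d - min (d - c * u) b := by
    rw [mul_max_of_nonneg _ _ hc.le, mul_div_cancel₀ _ hc.ne', max_def, min_def]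
    split_ifs <;> linarith
  rw [hset, measure_congr ((ae_eq_refl _).inter Ioo_ae_eq_Ioc), Ioc_inter_Ioc, Real.volume_Ioc,
    mul_max_of_nonneg _ _ (by positivity), mul_zero, ENNReal.ofReal_max, ENNReal.ofReal_zero,
    max_eq_left zero_le]
  congr 1
  field_simp
  linarith

theorem density_of_discrepancy (N : ℕ) (hN : 1 ≤ N)
    (x : Fin N → ℝ) (hx : ∀ n, x n ∈ Set.Icc (0:ℝ) 1) (hmono : Monotone x) :
    ∀ a b : ℝ, a < b →
      volume {t ∈ Set.Icc (0:ℝ) 1 | disc N x t ∈ Set.Ioo a b} =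
        ENNReal.ofReal (∫ t in a..b, discDensity N x t) := by
  intro a b hab
  have hc : (0:ℝ) < N := by exact_mod_cast hN
  have hy := xprev_monotone hx hmono
  have hdisj : Pairwise (Function.onFun Disjoint fun n =>
      Ioc (xprev N x n) (xprev N x (n + 1))) := hy.pairwise_disjoint_on_Ioc_succ
  have hcover : ⋃ n ∈ Finset.range (N + 1), Ioc (xprev N x n) (xprev N x (n + 1)) =
      Ioc (0:ℝ) 1 := by
    have h := hy.biUnion_Ico_Ioc_map_succ 0 (N + 1)
    rw [xprev_zero, xprev_succ, xe_of_le x le_rfl] at h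
    simpa using h
  have hpiece (n : ℕ) (hn : n ∈ Finset.range (N + 1)) :
      Ioc (xprev N x n) (xprev N x (n + 1)) ∩ {t | disc N x t ∈ Ioo a b} =
        Ioc (xprev N x n) (xprev N x (n + 1)) ∩ {t | (n : ℝ) - N * t ∈ Ioo a b} := by
    ext t
    refine and_congr_right fun ht => ?_
    rw [mem_ofPred_eq, mem_ofPred_eq,
      disc_eq_of_mem_Ioc hx hmono (Nat.lt_succ_iff.1 (Finset.mem_range.1 hn)) ht]
  have hmeas (n : ℕ) : MeasurableSet {t : ℝ | (n : ℝ) - N * t ∈ Ioo a b} :=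
    (by fun_prop : Measurable fun t : ℝ => (n : ℝ) - N * t) measurableSet_Ioo
  change volume (Icc (0:ℝ) 1 ∩ {t | disc N x t ∈ Ioo a b}) = _
  rw [measure_congr (Ioc_ae_eq_Icc.symm.inter (ae_eq_refl {t | disc N x t ∈ Ioo a b})), ← hcover, iUnion₂_inter,
    iUnion₂_congr hpiece, measure_biUnion_finset
      (fun m _ n _ hmn => (hdisj hmn).mono inter_subset_left inter_subset_left)
      (fun n _ => measurableSet_Ioc.inter (hmeas n)),
    intervalIntegral_discDensity hab.le, Finset.mul_sum,
    ENNReal.ofReal_sum_of_nonneg (fun n _ => by positivity)]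
  refine Finset.sum_congr rfl fun n _ => ?_
  rw [volume_Ioc_inter_affine_preimage hc, xprev_succ]
end

section
/- Let f, g, h : ℝ → [0,∞] be symmetrically decreasing functions with 0 ≤ g ≤ 1 and ∫_ℝ g(t) dt = 1, and let M_1 = 1_{(−1/2,1/2)}. Then ∫_ℝ h(x) (f ∗ g)(x) dx ≤ ∫_ℝ h(x) (f ∗ M_1)(x) dx, where (f ∗ g)(x) = ∫_ℝ f(x−y) g(y) dy denotes convolution. -/
open MeasureTheory Set

/-- Convolution of `[0,∞]`-valued functions on `ℝ`. -/
noncomputable def conv (f g : ℝ → ENNReal) (x : ℝ) : ENNReal := ∫⁻ y, f (x - y) * g y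

/-- A function `f : ℝ → [0,∞]` is symmetrically decreasing if `f(-x) = f(x)` for all `x`
and `f(y) ≤ f(x)` whenever `0 < x < y`. -/
def SymmDecr (f : ℝ → ENNReal) : Prop :=
  (∀ x : ℝ, f (-x) = f x) ∧ ∀ x y : ℝ, 0 < x → x < y → f y ≤ f x

/-- `M₁ = 1_{(−1/2, 1/2)}` as a `[0,∞]`-valued function. -/
noncomputable def M1 : ℝ → ENNReal := (Set.Ioo (-(1:ℝ)/2) (1/2)).indicator (fun _ => 1)

namespace SymmDecr

theorem apply_abs {f : ℝ → ENNReal} (hf : SymmDecr f) (x : ℝ) : f |x| = f x := by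
  rcases abs_choice x with h | h <;> rw [h]
  exact hf.1 x

theorem le_of_abs_le {f : ℝ → ENNReal} (hf : SymmDecr f) {x y : ℝ} (hx : x ≠ 0)
    (hxy : |x| ≤ |y|) : f y ≤ f x := by
  rw [← hf.apply_abs x, ← hf.apply_abs y]
  rcases hxy.eq_or_lt with h | h
  · rw [h]
  · exact hf.2 _ _ (abs_pos.mpr hx) h

theorem measurable {f : ℝ → ENNReal} (hf : SymmDecr f) : Measurable f := by
  have hanti : Antitone (fun t : ℝ => if 0 < t then f t else ⊤) := by
    intro a b hab
    by_cases ha : 0 < a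
    · have hb : 0 < b := ha.trans_le hab
      simp only [ha, hb, if_true]
      rcases hab.eq_or_lt with rfl | h
      · exact le_rfl
      · exact hf.2 _ _ ha h
    · simp [ha]
  have heq : f = fun x => if x = 0 then f 0 else (fun t : ℝ => if 0 < t then f t else ⊤) |x| := by
    funext x
    by_cases hx : x = 0
    · simp [hx]
    · simp [hx, hf.apply_abs]
  rw [heq]
  exact Measurable.ite (measurableSet_singleton 0) measurable_const
    (hanti.measurable.comp measurable_norm)

end SymmDecr

theorem ENNReal.mul_add_mul_le_mul_add_mul_of_le {a b c d : ENNReal} (hab : b ≤ a) (hcd : d ≤ c) :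
    a * d + b * c ≤ a * c + b * d := by
  obtain ⟨e, rfl⟩ := exists_add_of_le hab
  obtain ⟨s, rfl⟩ := exists_add_of_le hcd
  calc (b + e) * d + b * (d + s) ≤ (b + e) * d + b * (d + s) + e * s := le_self_add
    _ = (b + e) * (d + s) + b * d := by ring

/-- The correlation of two symmetrically decreasing functions is symmetrically decreasing. -/
theorem SymmDecr.lintegral_mul_sub {f h : ℝ → ENNReal} (hf : SymmDecr f) (hh : SymmDecr h) :
    SymmDecr (fun y => ∫⁻ x, h x * f (x - y)) := by
  have hfm := hf.measurable
  have hhm := hh.measurable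
  refine ⟨fun y => ?_, fun y z hy hyz => ?_⟩
  · dsimp only
    rw [← lintegral_neg_eq_self (μ := volume) (fun x => h x * f (x - -y))]
    refine lintegral_congr fun x => ?_
    rw [hh.1, ← hf.1 (x - y)]
    congr 2
    ring
  · dsimp only
    have key : ∀ w, ∫⁻ x, (h x * f (x - w) + h (y + z - x) * f (y + z - x - w))
        = 2 * ∫⁻ x, h x * f (x - w) := by
      intro w
      rw [lintegral_add_left (by fun_prop),
        lintegral_sub_left_eq_self (fun x => h x * f (x - w)) (y + z), two_mul]
    rw [← ENNReal.mul_le_mul_iff_right (a := 2) (by simp) (by simp), ← key, ← key]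
    have hne : ∀ c : ℝ, ∀ᵐ x : ℝ, x ≠ c := fun c => by
      simp [ae_iff]
    refine lintegral_mono_ae ?_
    filter_upwards [hne 0, hne y, hne z, hne (y + z)] with x h0 h1 h2 h3
    have e1 : f (y + z - x - z) = f (x - y) := by
      rw [← hf.1]; congr 1; ring
    have e2 : f (y + z - x - y) = f (x - z) := by
      rw [← hf.1]; congr 1; ring
    rw [e1, e2]
    rcases le_total x ((y + z) / 2) with hx | hx
    · refine ENNReal.mul_add_mul_le_mul_add_mul_of_le
        (hh.le_of_abs_le h0 ?_) (hf.le_of_abs_le (sub_ne_zero.mpr h1) ?_)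
      · exact sq_le_sq.mp (by nlinarith)
      · exact sq_le_sq.mp (by nlinarith)
    · rw [add_comm, add_comm (h x * f (x - y))]
      refine ENNReal.mul_add_mul_le_mul_add_mul_of_le
        (hh.le_of_abs_le (sub_ne_zero.mpr h3.symm) ?_) (hf.le_of_abs_le (sub_ne_zero.mpr h2) ?_)
      · exact sq_le_sq.mp (by nlinarith)
      · exact sq_le_sq.mp (by nlinarith)

/-- Bathtub principle: among measurable densities `0 ≤ g ≤ 1` of total mass one, `M1` maximizes the
integral against a symmetrically decreasing function. -/
theorem SymmDecr.lintegral_mul_le_setLIntegral {g K : ℝ → ENNReal} (hK : SymmDecr K)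
    (hg : Measurable g) (hg1 : ∀ x, g x ≤ 1) (hgint : ∫⁻ x, g x = 1) :
    ∫⁻ y, g y * K y ≤ ∫⁻ y in Ioo (-(1:ℝ)/2) (1/2), K y := by
  have hKm := hK.measurable
  set I : Set ℝ := Ioo (-(1:ℝ)/2) (1/2) with hI
  have hIm : MeasurableSet I := measurableSet_Ioo
  have hvol : volume I = 1 := by
    rw [hI, Real.volume_Ioo]; norm_num
  have hmass : ∫⁻ y in Iᶜ, g y = ∫⁻ y in I, (1 - g y) := by
    have h2 : (∫⁻ y in I, g y) + ∫⁻ y in I, (1 - g y) = 1 := by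
      rw [← lintegral_add_left hg]
      simp [add_tsub_cancel_of_le (hg1 _), hvol]
    have hfin : (∫⁻ y in I, g y) ≠ ⊤ :=
      ne_top_of_le_ne_top ENNReal.one_ne_top (h2 ▸ le_self_add)
    have h1 : (∫⁻ y in I, g y) + ∫⁻ y in Iᶜ, g y = 1 := by
      rw [← hgint]
      exact lintegral_add_compl g hIm
    exact (ENNReal.add_right_inj hfin).mp (h1.trans h2.symm)
  have houter : ∫⁻ y in Iᶜ, g y * K y ≤ ∫⁻ y in I, (1 - g y) * K y := by
    calc ∫⁻ y in Iᶜ, g y * K y ≤ ∫⁻ y in Iᶜ, g y * K (1/2) := by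
          refine setLIntegral_mono (by fun_prop) fun y hy => ?_
          gcongr
          refine hK.le_of_abs_le (by norm_num) ?_
          rw [abs_of_pos (by norm_num : (0:ℝ) < 1/2)]
          by_contra! hlt
          obtain ⟨ha, hb⟩ := abs_lt.mp hlt
          exact hy ⟨by linarith, hb⟩
      _ = ∫⁻ y in I, (1 - g y) * K (1/2) := by
          rw [lintegral_mul_const _ hg, hmass, lintegral_mul_const _ (by fun_prop)]
      _ ≤ ∫⁻ y in I, (1 - g y) * K y := by
          refine setLIntegral_mono_ae (by fun_prop) ?_
          have hne : ∀ᵐ y : ℝ, y ≠ 0 := by simp [ae_iff]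
          filter_upwards [hne] with y hy hyI
          gcongr
          refine hK.le_of_abs_le hy ?_
          rw [abs_of_pos (by norm_num : (0:ℝ) < 1/2)]
          exact abs_le.mpr ⟨by linarith [hyI.1], hyI.2.le⟩
  calc ∫⁻ y, g y * K y = (∫⁻ y in I, g y * K y) + ∫⁻ y in Iᶜ, g y * K y :=
        (lintegral_add_compl _ hIm).symm
    _ ≤ (∫⁻ y in I, g y * K y) + ∫⁻ y in I, (1 - g y) * K y := by gcongr
    _ = ∫⁻ y in I, K y := by
        rw [← lintegral_add_left (by fun_prop)]
        refine lintegral_congr fun y => ?_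
        rw [← add_mul, add_tsub_cancel_of_le (hg1 y), one_mul]

theorem lintegral_mul_conv {f g h : ℝ → ENNReal} (hf : Measurable f) (hg : Measurable g)
    (hh : Measurable h) :
    ∫⁻ x, h x * conv f g x = ∫⁻ y, g y * ∫⁻ x, h x * f (x - y) := by
  unfold conv
  calc ∫⁻ x, h x * ∫⁻ y, f (x - y) * g y = ∫⁻ x, ∫⁻ y, h x * (f (x - y) * g y) :=
        lintegral_congr fun x => (lintegral_const_mul _ (by fun_prop)).symm
    _ = ∫⁻ y, ∫⁻ x, h x * (f (x - y) * g y) := lintegral_lintegral_swap (by fun_prop)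
    _ = ∫⁻ y, g y * ∫⁻ x, h x * f (x - y) := by
        refine lintegral_congr fun y => ?_
        rw [← lintegral_const_mul _ (by fun_prop)]
        exact lintegral_congr fun x => by ring

theorem conv_inequality (f g h : ℝ → ENNReal)
    (hf : SymmDecr f) (hg : SymmDecr g) (hh : SymmDecr h)
    (hg1 : ∀ x, g x ≤ 1) (hgint : ∫⁻ x, g x = 1) :
    ∫⁻ x, h x * conv f g x ≤ ∫⁻ x, h x * conv f M1 x := by
  have hM : Measurable M1 := measurable_const.indicator measurableSet_Ioo
  rw [lintegral_mul_conv hf.measurable hg.measurable hh.measurable,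
    lintegral_mul_conv hf.measurable hM hh.measurable]
  refine ((hf.lintegral_mul_sub hh).lintegral_mul_le_setLIntegral
    hg.measurable hg1 hgint).trans_eq ?_
  rw [← lintegral_indicator measurableSet_Ioo]
  refine lintegral_congr fun y => ?_
  by_cases hy : y ∈ Ioo (-(1:ℝ)/2) (1/2)
  · rw [M1, indicator_of_mem hy, indicator_of_mem hy, one_mul]
  · rw [M1, indicator_of_notMem hy, indicator_of_notMem hy, zero_mul]
end

section
/- For every natural number N ≥ 1, every N-element point set P in [0,1], and every α > 0, the two-dimensional Lebesgue measure of {(t_1,t_2) ∈ [0,1]² : |D̃_P(t_1,t_2)| < α} is at most the two-dimensional Lebesgue measure of {(t_1,t_2) ∈ [0,1]² : |D̃_{Γ_N}(t_1,t_2)| < α}, where Γ_N is the centered regular grid. -/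
open MeasureTheory Set

/-- Two-parameter discrepancy function on `[0,1]²`. -/
noncomputable def disc2 (N : ℕ) (x : Fin N → ℝ) (t₁ t₂ : ℝ) : ℝ :=
  disc N x t₂ - disc N x t₁

open ProbabilityTheory

lemma exists_int_disc_eq {N : ℕ} (x : Fin N → ℝ) (t : ℝ) :
    ∃ k : ℤ, disc N x t = k - N * t := by
  refine ⟨∑ n : Fin N, (Ico (0:ℝ) t).indicator (fun _ => (1:ℤ)) (x n), ?_⟩
  simp only [disc, Int.cast_sum, indicator_apply, Int.cast_ite, Int.cast_one, Int.cast_zero]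

/-- Modulo `1` the discrepancy function is `t ↦ -N t`, so its law with respect to Lebesgue measure
on `[0,1]` has density at most `1`. -/
lemma volume_disc_preimage_Ioc_le {N : ℕ} (hN : 1 ≤ N) (x : Fin N → ℝ) (a b : ℝ) :
    volume.restrict (Icc (0:ℝ) 1) (disc N x ⁻¹' Ioc a b) ≤ ENNReal.ofReal (b - a) := by
  rcases le_or_gt b (a + 1) with hb | hb
  · have h1 : MeasurePreserving (fun t : ℝ => (-(N : ℤ)) • (t : AddCircle (1:ℝ)))
        (volume.restrict (Ioc (0:ℝ) (0 + 1))) volume :=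
      (Measure.measurePreserving_zsmul (volume : Measure (AddCircle (1:ℝ)))
        (n := -(N : ℤ)) (by omega)).comp (AddCircle.measurePreserving_mk 1 0)
    set B : Set (AddCircle (1:ℝ)) :=
      {θ | ((AddCircle.equivIoc (1:ℝ) a θ : Ioc a (a + 1)) : ℝ) ∈ Ioc a b} with hB
    have hBm : MeasurableSet B :=
      (measurable_subtype_coe.comp (AddCircle.measurableEquivIoc (1:ℝ) a).measurable)
        measurableSet_Ioc
    have hsub : disc N x ⁻¹' Ioc a b ⊆
        (fun t : ℝ => (-(N : ℤ)) • (t : AddCircle (1:ℝ))) ⁻¹' B := by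
      intro t ht
      have hcoe : (-(N : ℤ)) • (t : AddCircle (1:ℝ)) = ((disc N x t : ℝ) : AddCircle (1:ℝ)) := by
        obtain ⟨k, hk⟩ := exists_int_disc_eq x t
        rw [← AddCircle.coe_zsmul, ← sub_eq_zero, ← AddCircle.coe_sub, AddCircle.coe_eq_zero_iff]
        exact ⟨-k, by rw [hk]; push_cast [zsmul_eq_mul]; ring⟩
      simp only [mem_preimage, hB, mem_ofPred_eq]
      rw [hcoe, AddCircle.equivIoc_coe_of_mem (p := (1:ℝ)) ⟨ht.1, ht.2.trans hb⟩]
      exact ht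
    calc volume.restrict (Icc (0:ℝ) 1) (disc N x ⁻¹' Ioc a b)
        = volume.restrict (Ioc (0:ℝ) (0 + 1)) (disc N x ⁻¹' Ioc a b) := by
          rw [zero_add, restrict_Ioc_eq_restrict_Icc]
      _ ≤ volume.restrict (Ioc (0:ℝ) (0 + 1))
            ((fun t : ℝ => (-(N : ℤ)) • (t : AddCircle (1:ℝ))) ⁻¹' B) := measure_mono hsub
      _ = volume B := h1.measure_preimage hBm.nullMeasurableSet
      _ = volume.restrict (Ioc a (a + 1)) (((↑) : ℝ → AddCircle (1:ℝ)) ⁻¹' B) :=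
          ((AddCircle.measurePreserving_mk (1:ℝ) a).measure_preimage hBm.nullMeasurableSet).symm
      _ ≤ volume (Ioc a b) := by
          rw [Measure.restrict_apply' measurableSet_Ioc]
          refine measure_mono fun y hy => ?_
          have := hy.1
          simp only [mem_preimage, hB, mem_ofPred_eq] at this
          rwa [AddCircle.equivIoc_coe_of_mem (p := (1:ℝ)) hy.2] at this
      _ = ENNReal.ofReal (b - a) := Real.volume_Ioc
  · calc volume.restrict (Icc (0:ℝ) 1) (disc N x ⁻¹' Ioc a b)
        ≤ volume.restrict (Icc (0:ℝ) 1) univ := measure_mono (subset_univ _)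
      _ = ENNReal.ofReal 1 := by simp
      _ ≤ ENNReal.ofReal (b - a) := ENNReal.ofReal_le_ofReal (by linarith)

lemma measurable_disc (N : ℕ) (x : Fin N → ℝ) : Measurable (disc N x) := by
  unfold disc
  refine (Finset.measurable_sum _ fun n _ => ?_).sub (measurable_const.mul measurable_id)
  have h : MeasurableSet {t : ℝ | x n ∈ Ico 0 t} := by
    simp only [mem_Ico, ofPred_and]
    exact (MeasurableSet.const _).inter measurableSet_Ioi
  exact measurable_const.indicator h

lemma exists_cdf_eq {μ : Measure ℝ} (hc : Continuous (cdf μ)) {u : ℝ} (h0 : 0 < u) (h1 : u < 1) :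
    ∃ x, cdf μ x = u := by
  obtain ⟨a, ha⟩ := ((tendsto_cdf_atBot μ).eventually_lt_const h0).exists
  obtain ⟨b, hb⟩ := ((tendsto_cdf_atTop μ).eventually_const_lt h1).exists
  exact mem_range_of_exists_le_of_exists_ge hc ⟨a, ha.le⟩ ⟨b, hb.le⟩

section Cdf

variable {μ : Measure ℝ} [IsProbabilityMeasure μ]

lemma cdf_sub_cdf_le (h : ∀ a b, μ (Ioc a b) ≤ ENNReal.ofReal (b - a)) {a b : ℝ} (hab : a ≤ b) :
    cdf μ b - cdf μ a ≤ b - a := by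
  have h1 := h a b
  rw [← measure_cdf μ, StieltjesFunction.measure_Ioc] at h1
  exact (ENNReal.ofReal_le_ofReal_iff (sub_nonneg.2 hab)).1 h1

lemma abs_cdf_sub_cdf_le (h : ∀ a b, μ (Ioc a b) ≤ ENNReal.ofReal (b - a)) (a b : ℝ) :
    |cdf μ b - cdf μ a| ≤ |b - a| := by
  rcases le_total a b with hab | hab
  · rw [abs_of_nonneg (sub_nonneg.2 (monotone_cdf μ hab)), abs_of_nonneg (sub_nonneg.2 hab)]
    exact cdf_sub_cdf_le h hab
  · rw [abs_sub_comm, abs_sub_comm b,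
      abs_of_nonneg (sub_nonneg.2 (monotone_cdf μ hab)), abs_of_nonneg (sub_nonneg.2 hab)]
    exact cdf_sub_cdf_le h hab

/-- The probability integral transform. -/
lemma map_cdf_eq_volume_restrict (hc : Continuous (cdf μ)) :
    μ.map (cdf μ) = volume.restrict (Icc (0:ℝ) 1) := by
  have : IsProbabilityMeasure (μ.map (cdf μ)) :=
    Measure.isProbabilityMeasure_map hc.measurable.aemeasurable
  refine Measure.ext_of_Iic _ _ fun u => ?_
  have hvol : volume.restrict (Icc (0:ℝ) 1) (Iic u) = ENNReal.ofReal (min 1 u) := by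
    rw [Measure.restrict_apply measurableSet_Iic, inter_comm,
      show Icc (0:ℝ) 1 ∩ Iic u = Icc 0 (min 1 u) by ext; simp [and_assoc], Real.volume_Icc, sub_zero]
  rw [hvol, Measure.map_apply hc.measurable measurableSet_Iic]
  rcases lt_or_ge u 0 with h0 | h0
  · have : cdf μ ⁻¹' Iic u = ∅ :=
      eq_empty_of_forall_notMem fun y hy => (h0.trans_le (cdf_nonneg μ y)).not_ge hy
    rw [this, measure_empty, ENNReal.ofReal_of_nonpos ((min_le_right _ _).trans h0.le)]
  rcases le_or_gt 1 u with h1 | h1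
  · have : cdf μ ⁻¹' Iic u = univ := eq_univ_of_forall fun y => (cdf_le_one μ y).trans h1
    rw [this, measure_univ, min_eq_left h1, ENNReal.ofReal_one]
  rw [min_eq_right h1.le, ← ofReal_measureReal]
  congr 1
  apply le_antisymm
  · refine le_of_forall_gt_imp_ge_of_dense fun d hd => ?_
    rcases le_or_gt 1 d with hd1 | hd1
    · exact measureReal_le_one.trans hd1
    obtain ⟨y, rfl⟩ := exists_cdf_eq hc (h0.trans_lt hd) hd1
    rw [cdf_eq_real]
    exact measureReal_mono fun z hz => le_of_lt ((monotone_cdf μ).reflect_lt (hz.trans_lt hd))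
  · rcases h0.eq_or_lt with rfl | h0
    · exact measureReal_nonneg
    obtain ⟨y, rfl⟩ := exists_cdf_eq hc h0 h1
    conv_lhs => rw [cdf_eq_real]
    exact measureReal_mono fun z hz => monotone_cdf μ hz

end Cdf

/-- The law of the discrepancy function under Lebesgue measure on `[0,1]`. -/
noncomputable def discLaw (N : ℕ) (x : Fin N → ℝ) : Measure ℝ :=
  (volume.restrict (Icc (0:ℝ) 1)).map (disc N x)

instance (N : ℕ) (x : Fin N → ℝ) : IsProbabilityMeasure (discLaw N x) :=
  have : IsProbabilityMeasure (volume.restrict (Icc (0:ℝ) 1)) := ⟨by simp⟩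
  Measure.isProbabilityMeasure_map (measurable_disc N x).aemeasurable

lemma discLaw_Ioc_le {N : ℕ} (hN : 1 ≤ N) (x : Fin N → ℝ) (a b : ℝ) :
    discLaw N x (Ioc a b) ≤ ENNReal.ofReal (b - a) := by
  rw [discLaw, Measure.map_apply (measurable_disc N x) measurableSet_Ioc]
  exact volume_disc_preimage_Ioc_le hN x a b

lemma measurePreserving_cdf_disc {N : ℕ} (hN : 1 ≤ N) (x : Fin N → ℝ) :
    MeasurePreserving (fun t => cdf (discLaw N x) (disc N x t))
      (volume.restrict (Icc (0:ℝ) 1)) (volume.restrict (Icc (0:ℝ) 1)) := by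
  have hc : Continuous (cdf (discLaw N x)) :=
    (LipschitzWith.of_dist_le_mul (K := 1) fun a b => by
      simpa [Real.dist_eq] using abs_cdf_sub_cdf_le (discLaw_Ioc_le hN x) b a).continuous
  have h : MeasurePreserving (disc N x) (volume.restrict (Icc (0:ℝ) 1)) (discLaw N x) :=
    ⟨measurable_disc N x, rfl⟩
  exact MeasurePreserving.comp ⟨hc.measurable, map_cdf_eq_volume_restrict hc⟩ h

lemma volume_setOf_cdf_disc_lt {N : ℕ} (hN : 1 ≤ N) (x : Fin N → ℝ) (α : ℝ) :
    volume {p : ℝ × ℝ | p.1 ∈ Icc (0:ℝ) 1 ∧ p.2 ∈ Icc (0:ℝ) 1 ∧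
      |cdf (discLaw N x) (disc N x p.2) - cdf (discLaw N x) (disc N x p.1)| < α} =
    volume {p : ℝ × ℝ | p.1 ∈ Icc (0:ℝ) 1 ∧ p.2 ∈ Icc (0:ℝ) 1 ∧ |p.2 - p.1| < α} := by
  have hS : MeasurableSet {p : ℝ × ℝ | |p.2 - p.1| < α} :=
    (isOpen_lt (by fun_prop) continuous_const).measurableSet
  have h := measurePreserving_cdf_disc hN x
  have key := (h.prod h).measure_preimage hS.nullMeasurableSet
  rw [Measure.prod_restrict, Measure.restrict_apply' (measurableSet_Icc.prod measurableSet_Icc),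
    Measure.restrict_apply' (measurableSet_Icc.prod measurableSet_Icc), ← Measure.volume_eq_prod]
    at key
  convert key using 2
  · ext p
    simp only [mem_ofPred_eq, mem_inter_iff, mem_preimage, mem_prod, Prod.map_fst, Prod.map_snd]
    tauto
  · ext p
    simp only [mem_ofPred_eq, mem_inter_iff, mem_prod]
    tauto

lemma disc_grid_mem_Icc {N : ℕ} (hN : 1 ≤ N) {t : ℝ} (ht : t ∈ Icc (0:ℝ) 1) :
    disc N (grid N) t ∈ Icc (-(1/2) : ℝ) (1/2) := by
  have hN' : (0:ℝ) < N := by exact_mod_cast hN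
  set m : ℕ := ⌈N * t - 1/2⌉₊ with hm
  have hle : (N:ℝ) * t ≤ N := by nlinarith [ht.2]
  have hmN : m ≤ N := Nat.ceil_le.2 (by linarith)
  have hlow : N * t - 1/2 ≤ (m:ℝ) := Nat.le_ceil _
  have hup : (m:ℝ) ≤ N * t + 1/2 := by
    rcases le_or_gt 0 (N * t - 1/2 : ℝ) with h | h
    · linarith [Nat.ceil_lt_add_one h]
    · have : m = 0 := Nat.ceil_eq_zero.2 h.le
      rw [this, Nat.cast_zero]
      have := mul_nonneg hN'.le ht.1
      linarith
  have hsum : ∑ n : Fin N, (Ico (0:ℝ) t).indicator (fun _ => (1:ℝ)) (grid N n) = m := by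
    have hterm (n : Fin N) : (Ico (0:ℝ) t).indicator (fun _ => (1:ℝ)) (grid N n) =
        if (n : ℕ) < m then 1 else 0 := by
      rw [indicator_apply]
      congr 1
      simp only [grid, mem_Ico, eq_iff_iff, hm, Nat.lt_ceil]
      rw [div_lt_iff₀ (by positivity)]
      constructor
      · rintro ⟨-, h⟩; linarith
      · intro h; exact ⟨by positivity, by linarith⟩
    simp_rw [hterm]
    rw [Fin.sum_univ_eq_sum_range (fun n => if n < m then (1:ℝ) else 0) N, Finset.sum_ite,
      Finset.sum_const_zero, add_zero, Finset.sum_const, nsmul_one,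
      show (Finset.range N).filter (· < m) = Finset.range m by ext; simp; omega, Finset.card_range]
  simp only [disc, hsum, mem_Icc]
  constructor <;> linarith

/-- The discrepancy function of the centered regular grid is uniform on `[-1/2,1/2]`. -/
lemma cdf_discLaw_grid {N : ℕ} (hN : 1 ≤ N) {u : ℝ} (hu : u ∈ Icc (-(1/2) : ℝ) (1/2)) :
    cdf (discLaw N (grid N)) u = u + 1/2 := by
  have hlaw := discLaw_Ioc_le hN (grid N)
  have htop : cdf (discLaw N (grid N)) (1/2) = 1 := by
    rw [cdf_eq_real, ← compl_compl (Iic (1/2 : ℝ)), probReal_compl_eq_one_sub measurableSet_Iic.compl,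
      sub_eq_self, measureReal_eq_zero_iff, discLaw,
      Measure.map_apply (measurable_disc _ _) measurableSet_Iic.compl,
      Measure.restrict_apply' measurableSet_Icc]
    convert measure_empty (μ := (volume : Measure ℝ))
    refine eq_empty_of_forall_notMem fun t ht => ht.1 (disc_grid_mem_Icc hN ht.2).2
  have hbot (ε : ℝ) (hε : 0 < ε) : cdf (discLaw N (grid N)) (-(1/2) - ε) = 0 := by
    rw [cdf_eq_real, measureReal_eq_zero_iff, discLaw,
      Measure.map_apply (measurable_disc _ _) measurableSet_Iic,
      Measure.restrict_apply' measurableSet_Icc]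
    convert measure_empty (μ := (volume : Measure ℝ))
    refine eq_empty_of_forall_notMem fun t ht => ?_
    have h1 := (disc_grid_mem_Icc hN ht.2).1
    have h2 : disc N (grid N) t ≤ -(1/2) - ε := ht.1
    linarith
  apply le_antisymm
  · refine le_of_forall_pos_le_add fun ε hε => ?_
    have := cdf_sub_cdf_le hlaw (a := -(1/2) - ε) (b := u) (by linarith [hu.1])
    linarith [hbot ε hε]
  · linarith [cdf_sub_cdf_le hlaw hu.2]

theorem extremal_distribution_two_param (N : ℕ) (hN : 1 ≤ N)
    (x : Fin N → ℝ) (hx : ∀ n, x n ∈ Set.Icc (0:ℝ) 1) (α : ℝ) (hα : 0 < α) :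
    volume {p : ℝ × ℝ | p.1 ∈ Set.Icc (0:ℝ) 1 ∧ p.2 ∈ Set.Icc (0:ℝ) 1 ∧
        |disc2 N x p.1 p.2| < α} ≤
      volume {p : ℝ × ℝ | p.1 ∈ Set.Icc (0:ℝ) 1 ∧ p.2 ∈ Set.Icc (0:ℝ) 1 ∧
        |disc2 N (grid N) p.1 p.2| < α} := by
  calc _ ≤ volume {p : ℝ × ℝ | p.1 ∈ Icc (0:ℝ) 1 ∧ p.2 ∈ Icc (0:ℝ) 1 ∧
        |cdf (discLaw N x) (disc N x p.2) - cdf (discLaw N x) (disc N x p.1)| < α} :=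
        measure_mono fun p hp => ⟨hp.1, hp.2.1,
          (abs_cdf_sub_cdf_le (discLaw_Ioc_le hN x) _ _).trans_lt hp.2.2⟩
    _ = volume {p : ℝ × ℝ | p.1 ∈ Icc (0:ℝ) 1 ∧ p.2 ∈ Icc (0:ℝ) 1 ∧
        |cdf (discLaw N (grid N)) (disc N (grid N) p.2) -
          cdf (discLaw N (grid N)) (disc N (grid N) p.1)| < α} := by
        rw [volume_setOf_cdf_disc_lt hN, volume_setOf_cdf_disc_lt hN]
    _ ≤ _ := by
        refine measure_mono fun p ⟨h1, h2, h3⟩ => ⟨h1, h2, ?_⟩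
        rw [cdf_discLaw_grid hN (disc_grid_mem_Icc hN h1),
          cdf_discLaw_grid hN (disc_grid_mem_Icc hN h2), add_sub_add_right_eq_sub] at h3
        exact h3
end

section
/- For every natural number N ≥ 1 and every α ≥ 0, the Lebesgue measure of {t ∈ [0,1] : |D_{Γ_N}(t)| ≥ α} equals max(0, 1 − 2α), where Γ_N is the centered regular grid. -/
open MeasureTheory Set

theorem disc_grid_eq {N m : ℕ} (hN : 1 ≤ N) (hm : m ≤ N) {t : ℝ}
    (h₁ : 2 * (m : ℝ) - 1 < 2 * (N * t)) (h₂ : 2 * (N * t) ≤ 2 * (m : ℝ) + 1) :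
    disc N (grid N) t = m - N * t := by
  have hN' : (0 : ℝ) < N := by exact_mod_cast hN
  have key (n : ℕ) : (2 * (n : ℝ) + 1) / (2 * N) ∈ Ico (0 : ℝ) t ↔ n < m := by
    have h₀ : 0 ≤ (2 * (n : ℝ) + 1) / (2 * N) := by positivity
    rw [mem_Ico, and_iff_right h₀, div_lt_iff₀ (by positivity)]
    constructor
    · intro h
      have : (n : ℝ) < m := by linarith
      exact_mod_cast this
    · intro h
      have : (n : ℝ) + 1 ≤ m := by exact_mod_cast h
      linarith
  have hsum : ∑ n : Fin N, (Ico (0 : ℝ) t).indicator (fun _ => (1 : ℝ)) (grid N n) = m := by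
    simp only [grid, indicator_apply, key]
    rw [Fin.sum_univ_eq_sum_range (fun n => if n < m then (1 : ℝ) else 0) N,
      ← Finset.sum_filter]
    have : (Finset.range N).filter (· < m) = Finset.range m := by
      ext n
      simp only [Finset.mem_filter, Finset.mem_range]
      omega
    rw [this]
    simp
  rw [disc, hsum]

theorem abs_disc_grid_eq_min {N k : ℕ} (hk : k < N) {t : ℝ}
    (h₁ : (k : ℝ) ≤ N * t) (h₂ : N * t ≤ k + 1) :
    |disc N (grid N) t| = min (N * t - k) (k + 1 - N * t) := by
  rcases le_or_gt (2 * (N * t)) (2 * (k : ℝ) + 1) with h | h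
  · rw [disc_grid_eq (by omega) hk.le (by linarith) h, min_eq_left (by linarith),
      abs_of_nonpos (by linarith), neg_sub]
  · rw [disc_grid_eq (m := k + 1) (by omega) hk (by push_cast; linarith) (by push_cast; linarith),
      min_eq_right (by linarith), Nat.cast_succ, abs_of_nonneg (by linarith)]

theorem setOf_le_abs_disc_grid {N : ℕ} (hN : 1 ≤ N) {α : ℝ} (hα : 0 ≤ α) :
    {t ∈ Icc (0 : ℝ) 1 | α ≤ |disc N (grid N) t|} =
      ⋃ k ∈ Finset.range N, Icc (((k : ℝ) + α) / N) ((k + 1 - α) / N) := by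
  have hN' : (0 : ℝ) < N := by exact_mod_cast hN
  ext t
  simp only [mem_ofPred_eq, mem_iUnion, Finset.mem_range, exists_prop, mem_Icc,
    div_le_iff₀ hN', le_div_iff₀ hN', mul_comm t]
  constructor
  · rintro ⟨⟨h₀, h₁⟩, h⟩
    obtain ⟨k, hk, hk₁, hk₂⟩ : ∃ k < N, (k : ℝ) ≤ N * t ∧ N * t ≤ k + 1 := by
      rcases h₁.eq_or_lt with rfl | h₁
      · refine ⟨N - 1, by omega, ?_, ?_⟩ <;> push_cast [Nat.cast_sub hN] <;> linarith
      · exact ⟨⌊N * t⌋₊, (Nat.floor_lt (by positivity)).2 (by nlinarith),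
          Nat.floor_le (by positivity), (Nat.lt_floor_add_one _).le⟩
    rw [abs_disc_grid_eq_min hk hk₁ hk₂, le_min_iff] at h
    exact ⟨k, hk, by linarith, by linarith⟩
  · rintro ⟨k, hk, h₁, h₂⟩
    have hk' : (k : ℝ) + 1 ≤ N := by exact_mod_cast hk
    have hk₀ : (0 : ℝ) ≤ k := k.cast_nonneg
    refine ⟨⟨?_, ?_⟩, ?_⟩
    · exact nonneg_of_mul_nonneg_right (by linarith) hN'
    · exact le_of_mul_le_mul_left (by linarith) hN'
    · rw [abs_disc_grid_eq_min hk (by linarith) (by linarith), le_min_iff]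
      exact ⟨by linarith, by linarith⟩

theorem distribution_of_grid_one_param (N : ℕ) (hN : 1 ≤ N) (α : ℝ) (hα : 0 ≤ α) :
    volume {t ∈ Set.Icc (0:ℝ) 1 | α ≤ |disc N (grid N) t|} =
      ENNReal.ofReal (max 0 (1 - 2 * α)) := by
  have hN' : (0 : ℝ) < N := by exact_mod_cast hN
  rcases hα.eq_or_lt with rfl | hα'
  · have : {t ∈ Icc (0 : ℝ) 1 | 0 ≤ |disc N (grid N) t|} = Icc 0 1 :=
      Set.ext fun t => and_iff_left (abs_nonneg _)
    rw [this]
    simp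
  have hdisj : (Finset.range N : Set ℕ).PairwiseDisjoint
      fun k : ℕ => Icc (((k : ℝ) + α) / N) ((k + 1 - α) / N) := by
    intro j _ k _ hjk
    refine Set.disjoint_left.2 fun t hj hk => hjk ?_
    simp only [mem_Icc, div_le_iff₀ hN', le_div_iff₀ hN'] at hj hk
    have h₁ : (j : ℝ) < k + 1 := by linarith
    have h₂ : (k : ℝ) < j + 1 := by linarith
    norm_cast at h₁ h₂
    omega
  rw [setOf_le_abs_disc_grid hN hα,
    measure_biUnion_finset hdisj fun _ _ => measurableSet_Icc]
  have hlen (k : ℕ) : ((k : ℝ) + 1 - α) / N - (k + α) / N = (1 - 2 * α) / N := by ring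
  simp only [Real.volume_Icc, hlen, Finset.sum_const, Finset.card_range]
  rw [← ENNReal.ofReal_nsmul, nsmul_eq_mul, mul_div_cancel₀ _ hN'.ne', max_comm,
    ENNReal.ofReal_max, ENNReal.ofReal_zero, max_eq_left zero_le]
end

section
/- For every N-element point set P = {x_0, ..., x_{N-1}} ⊂ [0,1], the squared L₂ norm of the two-parameter discrepancy function over the triangle {(t_1,t_2) : 0 ≤ t_1 ≤ t_2 ≤ 1} satisfies ∫_0^1 ∫_{t_1}^1 D̃_P(t_1,t_2)² dt_2 dt_1 = 1/12 + (1/2) Σ_{n=0}^{N−1} Σ_{m=0}^{N−1} (x_n − x_m − (n−m)/N)². -/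
open MeasureTheory Set

/-- The integral over the triangle `t₁ ≤ t₂` of a bounded symmetric function is half its integral
over the square. -/
lemma integral_triangle_add_self_of_symm {F : ℝ → ℝ → ℝ} (hF : Measurable (Function.uncurry F))
    {C : ℝ} (hC : ∀ s t, |F s t| ≤ C) (hsymm : ∀ s t, F s t = F t s) :
    (∫ s in (0:ℝ)..1, ∫ t in s..1, F s t) + (∫ s in (0:ℝ)..1, ∫ t in s..1, F s t) =
      ∫ s in (0:ℝ)..1, ∫ t in (0:ℝ)..1, F s t := by
  have hFs : ∀ s, Measurable (F s) := fun s => hF.comp measurable_prodMk_left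
  have hint : ∀ s a b, IntervalIntegrable (F s) volume a b := fun s a b =>
    (intervalIntegrable_const (c := C)).mono_fun (hFs s).aestronglyMeasurable
      (Filter.Eventually.of_forall fun t => by
        simpa using (hC s t).trans (le_abs_self C))
  set G : ℝ → ℝ → ℝ := fun s t => if s < t then F s t else 0 with hG
  have hGm : Measurable (Function.uncurry G) :=
    Measurable.ite (measurableSet_lt measurable_fst measurable_snd) hF measurable_const
  have hC0 : 0 ≤ C := (abs_nonneg _).trans (hC 0 0)
  have hGC : ∀ s t, |G s t| ≤ C := by
    intro s t
    by_cases h : s < t <;> simp [hG, h, hC, hC0]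
  have hupper : ∀ s ∈ Icc (0:ℝ) 1, ∫ t in (0:ℝ)..1, G s t = ∫ t in s..1, F s t := by
    intro s hs
    rw [intervalIntegral.integral_of_le zero_le_one, intervalIntegral.integral_of_le hs.2]
    have : G s = (Ioi s).indicator (F s) := by
      ext t; simp [hG, indicator_apply]
    rw [this, setIntegral_indicator measurableSet_Ioi]
    congr 2
    ext t
    simp only [mem_inter_iff, mem_Ioc, mem_Ioi]
    exact ⟨fun h => ⟨h.2, h.1.2⟩, fun h => ⟨⟨hs.1.trans_lt h.1, h.2⟩, h.1⟩⟩
  have hlower : ∀ s ∈ Icc (0:ℝ) 1, ∫ t in (0:ℝ)..1, G t s = ∫ t in (0:ℝ)..s, F s t := by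
    intro s hs
    rw [intervalIntegral.integral_of_le zero_le_one, intervalIntegral.integral_of_le hs.1,
      integral_Ioc_eq_integral_Ioo (y := s)]
    have : (fun t => G t s) = (Iio s).indicator (F s) := by
      ext t; simp [hG, indicator_apply, hsymm t s]
    rw [this, setIntegral_indicator measurableSet_Iio]
    congr 2
    ext t
    simp only [mem_inter_iff, mem_Ioc, mem_Iio, mem_Ioo]
    exact ⟨fun h => ⟨h.1.1, h.2⟩, fun h => ⟨⟨h.1, (h.2.trans_le hs.2).le⟩, h.2⟩⟩
  have hGint : Integrable (Function.uncurry G)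
      ((volume.restrict (Ioc (0:ℝ) 1)).prod (volume.restrict (Ioc (0:ℝ) 1))) :=
    Integrable.of_bound hGm.aestronglyMeasurable C
      (Filter.Eventually.of_forall fun p => hGC p.1 p.2)
  have hswap : ∫ s in (0:ℝ)..1, ∫ t in (0:ℝ)..1, G s t =
      ∫ s in (0:ℝ)..1, ∫ t in (0:ℝ)..1, G t s := by
    simp only [intervalIntegral.integral_of_le (zero_le_one' ℝ)]
    exact integral_integral_swap hGint
  have hi1 : IntervalIntegrable (fun s => ∫ t in (0:ℝ)..1, G s t) volume 0 1 := by
    rw [intervalIntegrable_iff_integrableOn_Ioc_of_le zero_le_one]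
    simp only [intervalIntegral.integral_of_le (zero_le_one' ℝ)]
    exact hGint.integral_prod_left
  have hi2 : IntervalIntegrable (fun s => ∫ t in (0:ℝ)..1, G t s) volume 0 1 := by
    rw [intervalIntegrable_iff_integrableOn_Ioc_of_le zero_le_one]
    simp only [intervalIntegral.integral_of_le (zero_le_one' ℝ)]
    exact hGint.integral_prod_right
  have hT : ∫ s in (0:ℝ)..1, ∫ t in s..1, F s t = ∫ s in (0:ℝ)..1, ∫ t in (0:ℝ)..1, G s t := by
    refine intervalIntegral.integral_congr fun s hs => ?_
    rw [uIcc_of_le zero_le_one] at hs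
    exact (hupper s hs).symm
  rw [hT]
  nth_rewrite 2 [hswap]
  rw [← intervalIntegral.integral_add hi1 hi2]
  refine intervalIntegral.integral_congr fun s hs => ?_
  rw [uIcc_of_le zero_le_one] at hs
  rw [hupper s hs, hlower s hs, add_comm,
    intervalIntegral.integral_add_adjacent_intervals (hint s _ _) (hint s _ _)]

lemma integral_triangle_sub_sq {D : ℝ → ℝ} (hD : Measurable D) {C : ℝ} (hC : ∀ t, |D t| ≤ C) :
    ∫ s in (0:ℝ)..1, ∫ t in s..1, (D t - D s) ^ 2 =
      (∫ t in (0:ℝ)..1, D t ^ 2) - (∫ t in (0:ℝ)..1, D t) ^ 2 := by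
  have hi : IntervalIntegrable D volume 0 1 :=
    (intervalIntegrable_const (c := C)).mono_fun hD.aestronglyMeasurable
      (Filter.Eventually.of_forall fun t => by simpa using (hC t).trans (le_abs_self C))
  have hi2 : IntervalIntegrable (fun t => D t ^ 2) volume 0 1 :=
    (intervalIntegrable_const (c := C ^ 2)).mono_fun (hD.pow_const 2).aestronglyMeasurable
      (Filter.Eventually.of_forall fun t => by
        simpa using sq_le_sq.2 ((hC t).trans (le_abs_self C)))
  have key := integral_triangle_add_self_of_symm (F := fun s t => (D t - D s) ^ 2)
    (C := (2 * C) ^ 2)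
    (((hD.comp measurable_snd).sub (hD.comp measurable_fst)).pow_const 2)
    (fun s t => by
      rw [abs_of_nonneg (sq_nonneg _)]
      refine sq_le_sq' ?_ ?_ <;>
        linarith [(abs_le.1 (hC s)).1, (abs_le.1 (hC s)).2, (abs_le.1 (hC t)).1,
          (abs_le.1 (hC t)).2])
    (fun s t => by ring)
  have hinner : ∀ s, ∫ t in (0:ℝ)..1, (D t - D s) ^ 2 =
      (∫ t in (0:ℝ)..1, D t ^ 2) - 2 * (∫ t in (0:ℝ)..1, D t) * D s + D s ^ 2 := by
    intro s
    have : ∀ t, (D t - D s) ^ 2 = D t ^ 2 - 2 * D s * D t + D s ^ 2 := fun t => by ring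
    simp only [this]
    rw [intervalIntegral.integral_add (hi2.sub (hi.const_mul _)) intervalIntegrable_const,
      intervalIntegral.integral_sub hi2 (hi.const_mul _), intervalIntegral.integral_const_mul,
      intervalIntegral.integral_const]
    simp only [sub_zero, one_smul]
    ring
  simp only [hinner] at key
  rw [intervalIntegral.integral_add (intervalIntegrable_const.sub (hi.const_mul _)) hi2,
    intervalIntegral.integral_sub intervalIntegrable_const (hi.const_mul _),
    intervalIntegral.integral_const_mul, intervalIntegral.integral_const] at key
  simp only [sub_zero, one_smul] at key
  linarith

lemma integral_indicator_Ioi_mul {a : ℝ} (ha : a ∈ Icc (0:ℝ) 1) (f : ℝ → ℝ) :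
    ∫ t in (0:ℝ)..1, (Ioi a).indicator 1 t * f t = ∫ t in a..1, f t := by
  rw [intervalIntegral.integral_of_le zero_le_one, intervalIntegral.integral_of_le ha.2]
  have : (fun t => (Ioi a).indicator 1 t * f t) = (Ioi a).indicator f := by
    ext t; simp [indicator_apply]
  rw [this, setIntegral_indicator measurableSet_Ioi]
  congr 2
  ext t
  simp only [mem_inter_iff, mem_Ioc, mem_Ioi]
  exact ⟨fun h => ⟨h.2, h.1.2⟩, fun h => ⟨⟨ha.1.trans_lt h.1, h.2⟩, h.1⟩⟩

lemma intervalIntegrable_indicator_Ioi_mul (a : ℝ) {f : ℝ → ℝ} (hf : Continuous f) (b c : ℝ) :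
    IntervalIntegrable (fun t => (Ioi a).indicator 1 t * f t) volume b c := by
  refine (hf.intervalIntegrable b c).mono_fun
    ((measurable_one.indicator measurableSet_Ioi).mul hf.measurable).aestronglyMeasurable
    (Filter.Eventually.of_forall fun t => ?_)
  by_cases h : a < t <;> simp [h]

/-- The one-parameter discrepancy function of a finite family of points, for `t ∈ [0, 1]`. -/
noncomputable def discrepancy {N : ℕ} (x : Fin N → ℝ) (t : ℝ) : ℝ :=
  (∑ n, (Ioi (x n)).indicator 1 t) - N * t

lemma measurable_discrepancy {N : ℕ} (x : Fin N → ℝ) : Measurable (discrepancy x) :=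
  (Finset.measurable_sum _ fun _ _ => measurable_one.indicator measurableSet_Ioi).sub
    (measurable_const.mul measurable_id)

lemma integral_discrepancy {N : ℕ} {x : Fin N → ℝ} (hx : ∀ n, x n ∈ Icc (0:ℝ) 1) :
    ∫ t in (0:ℝ)..1, discrepancy x t = N / 2 - ∑ n, x n := by
  have h1 : ∀ n, IntervalIntegrable (fun t => (Ioi (x n)).indicator (1 : ℝ → ℝ) t) volume 0 1 :=
    fun n => by
      simpa using intervalIntegrable_indicator_Ioi_mul (x n) (continuous_const (y := (1:ℝ))) 0 1
  have h2 : ∀ n, ∫ t in (0:ℝ)..1, (Ioi (x n)).indicator (1 : ℝ → ℝ) t = 1 - x n := fun n => by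
    simpa using integral_indicator_Ioi_mul (hx n) (fun _ => 1)
  have hc : Continuous fun t : ℝ => (N : ℝ) * t := by fun_prop
  have h1s : IntervalIntegrable (fun t => ∑ n, (Ioi (x n)).indicator (1 : ℝ → ℝ) t) volume 0 1 := by
    simpa only [Finset.sum_fn] using IntervalIntegrable.sum Finset.univ fun n _ => h1 n
  simp only [discrepancy]
  rw [intervalIntegral.integral_sub h1s (hc.intervalIntegrable _ _),
    intervalIntegral.integral_finsetSum fun n _ => h1 n]
  have h3 : ∫ t in (0:ℝ)..1, (N : ℝ) * t = N / 2 := by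
    rw [intervalIntegral.integral_const_mul, integral_id]
    ring
  simp only [h2, h3, Finset.sum_sub_distrib, Finset.sum_const, Finset.card_univ,
    Fintype.card_fin, nsmul_eq_mul]
  ring

lemma integral_discrepancy_sq {N : ℕ} {x : Fin N → ℝ} (hx : ∀ n, x n ∈ Icc (0:ℝ) 1) :
    ∫ t in (0:ℝ)..1, discrepancy x t ^ 2 =
      N ^ 2 / 3 - (∑ n, ∑ m, max (x n) (x m)) + N * ∑ n, x n ^ 2 := by
  have hexp : ∀ t, discrepancy x t ^ 2 =
      (∑ n, ∑ m, (Ioi (max (x n) (x m))).indicator 1 t * 1) -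
        (∑ n, (Ioi (x n)).indicator 1 t * (2 * N * t)) + N ^ 2 * t ^ 2 := by
    intro t
    have : ∀ n m, (Ioi (max (x n) (x m))).indicator (1 : ℝ → ℝ) t * 1 =
        (Ioi (x n)).indicator 1 t * (Ioi (x m)).indicator 1 t := by
      intro n m
      by_cases h : x n < t <;> by_cases h' : x m < t <;> simp [h, h']
    simp only [this, ← Finset.sum_mul, ← Finset.mul_sum, discrepancy]
    ring
  have hmax : ∀ n m, max (x n) (x m) ∈ Icc (0:ℝ) 1 := fun n m =>
    ⟨le_max_of_le_left (hx n).1, max_le (hx n).2 (hx m).2⟩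
  have hi1 : ∀ n m, IntervalIntegrable
      (fun t => (Ioi (max (x n) (x m))).indicator (1 : ℝ → ℝ) t * 1) volume 0 1 := fun n m =>
    intervalIntegrable_indicator_Ioi_mul _ continuous_const _ _
  have hi1s : ∀ n, IntervalIntegrable
      (fun t => ∑ m, (Ioi (max (x n) (x m))).indicator (1 : ℝ → ℝ) t * 1) volume 0 1 := fun n => by
    simpa only [Finset.sum_fn] using
      IntervalIntegrable.sum Finset.univ fun m _ => hi1 n m
  have hi1ss : IntervalIntegrable
      (fun t => ∑ n, ∑ m, (Ioi (max (x n) (x m))).indicator (1 : ℝ → ℝ) t * 1) volume 0 1 := by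
    simpa only [Finset.sum_fn] using IntervalIntegrable.sum Finset.univ fun n _ => hi1s n
  have hi2 : ∀ n, IntervalIntegrable
      (fun t => (Ioi (x n)).indicator (1 : ℝ → ℝ) t * (2 * N * t)) volume 0 1 := fun n =>
    intervalIntegrable_indicator_Ioi_mul _ (by fun_prop) _ _
  have hi2s : IntervalIntegrable
      (fun t => ∑ n, (Ioi (x n)).indicator (1 : ℝ → ℝ) t * (2 * N * t)) volume 0 1 := by
    simpa only [Finset.sum_fn] using IntervalIntegrable.sum Finset.univ fun n _ => hi2 n
  have hc : Continuous fun t : ℝ => (N : ℝ) ^ 2 * t ^ 2 := by fun_prop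
  simp only [hexp]
  rw [intervalIntegral.integral_add (hi1ss.sub hi2s) (hc.intervalIntegrable _ _),
    intervalIntegral.integral_sub hi1ss hi2s,
    intervalIntegral.integral_finsetSum fun n _ => hi1s n,
    intervalIntegral.integral_finsetSum fun n _ => hi2 n]
  have e1 : ∀ n, ∫ t in (0:ℝ)..1, ∑ m, (Ioi (max (x n) (x m))).indicator (1 : ℝ → ℝ) t * 1 =
      ∑ m, (1 - max (x n) (x m)) := fun n => by
    rw [intervalIntegral.integral_finsetSum fun m _ => hi1 n m]
    refine Finset.sum_congr rfl fun m _ => ?_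
    rw [integral_indicator_Ioi_mul (hmax n m) (fun _ => 1), intervalIntegral.integral_const]
    simp
  have e2 : ∀ n, ∫ t in (0:ℝ)..1, (Ioi (x n)).indicator (1 : ℝ → ℝ) t * (2 * N * t) =
      N - N * x n ^ 2 := fun n => by
    rw [integral_indicator_Ioi_mul (hx n) (fun t => 2 * N * t),
      intervalIntegral.integral_const_mul, integral_id]
    ring
  simp only [e1, e2, Finset.sum_sub_distrib, intervalIntegral.integral_const_mul, integral_pow,
    Finset.sum_const, Finset.card_univ, Fintype.card_fin, nsmul_eq_mul, ← Finset.mul_sum]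
  norm_num
  ring

lemma sum_sum_max_of_monotone {N : ℕ} {x : Fin N → ℝ} (hx : Monotone x) :
    ∑ n, ∑ m, max (x n) (x m) = ∑ n : Fin N, (2 * (n : ℝ) + 1) * x n := by
  induction N with
  | zero => simp
  | succ N ih =>
    have h := ih (x := fun n => x n.castSucc) (hx.comp Fin.strictMono_castSucc.monotone)
    have hl : ∀ n : Fin N, x n.castSucc ≤ x (Fin.last N) := fun n => hx (Fin.le_last _)
    simp only [Fin.sum_univ_castSucc, Finset.sum_add_distrib, h, max_eq_right (hl _),
      max_eq_left (hl _), max_self, Finset.sum_const, Finset.card_univ, Fintype.card_fin,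
      nsmul_eq_mul, Fin.val_castSucc, Fin.val_last]
    ring

lemma sum_sum_sub_sq {N : ℕ} (y : Fin N → ℝ) :
    ∑ n, ∑ m, (y n - y m) ^ 2 = 2 * (N * ∑ n, y n ^ 2 - (∑ n, y n) ^ 2) := by
  have : ∀ n m, (y n - y m) ^ 2 = y n ^ 2 - 2 * (y n * y m) + y m ^ 2 := fun n m => by ring
  simp only [this, Finset.sum_add_distrib, Finset.sum_sub_distrib, ← Finset.mul_sum,
    ← Finset.sum_mul, Finset.sum_const, Finset.card_univ, Fintype.card_fin, nsmul_eq_mul]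
  ring

lemma sum_fin_val (N : ℕ) : ∑ n : Fin N, (n : ℝ) = N * (N - 1) / 2 := by
  induction N with
  | zero => simp
  | succ N ih =>
    simp only [Fin.sum_univ_castSucc, Fin.val_castSucc, Fin.val_last, ih]
    push_cast
    ring

lemma sum_fin_val_sq (N : ℕ) : ∑ n : Fin N, (n : ℝ) ^ 2 = N * (N - 1) * (2 * N - 1) / 6 := by
  induction N with
  | zero => simp
  | succ N ih =>
    simp only [Fin.sum_univ_castSucc, Fin.val_castSucc, Fin.val_last, ih]
    push_cast
    ring

theorem extreme_L2_discrepancy_formula (N : ℕ) (hN : 1 ≤ N)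
    (x : Fin N → ℝ) (hx : ∀ n, x n ∈ Set.Icc (0:ℝ) 1) (hmono : Monotone x) :
    (∫ t₁ in (0:ℝ)..1, ∫ t₂ in t₁..1,
        ((∑ n : Fin N, (Set.Ico t₁ t₂).indicator (fun _ => (1:ℝ)) (x n)) -
          N * (t₂ - t₁)) ^ 2) =
      1 / 12 + (1 / 2) * ∑ n : Fin N, ∑ m : Fin N,
        (x n - x m - ((n : ℝ) - (m : ℝ)) / N) ^ 2 := by
  have hN0 : (N : ℝ) ≠ 0 := by positivity
  -- Truncating to `[0, 1]` makes the discrepancy function bounded on all of `ℝ`.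
  set D : ℝ → ℝ := (Icc (0:ℝ) 1).indicator (discrepancy x) with hD
  have hDm : Measurable D := (measurable_discrepancy x).indicator measurableSet_Icc
  have hDeq : ∀ t ∈ Icc (0:ℝ) 1, D t = discrepancy x t := fun t ht => indicator_of_mem ht _
  have hDC : ∀ t, |D t| ≤ N := by
    intro t
    by_cases ht : t ∈ Icc (0:ℝ) 1
    · rw [hDeq t ht, discrepancy]
      have h0 : 0 ≤ ∑ n, (Ioi (x n)).indicator (1 : ℝ → ℝ) t :=
        Finset.sum_nonneg fun n _ => indicator_nonneg (fun _ _ => zero_le_one) t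
      have h1 : ∑ n, (Ioi (x n)).indicator (1 : ℝ → ℝ) t ≤ N := by
        refine (Finset.sum_le_sum (g := fun _ => (1:ℝ)) fun n _ => ?_).trans (by simp)
        exact indicator_le_self' (fun _ _ => zero_le_one) t
      have hNt : (N : ℝ) * t ≤ N := mul_le_of_le_one_right (Nat.cast_nonneg N) ht.2
      have hNt0 : 0 ≤ (N : ℝ) * t := mul_nonneg (Nat.cast_nonneg N) ht.1
      exact abs_le.2 ⟨by linarith, by linarith⟩
    · simp [hD, indicator_of_notMem ht]
  have hL : (∫ t₁ in (0:ℝ)..1, ∫ t₂ in t₁..1,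
      ((∑ n : Fin N, (Set.Ico t₁ t₂).indicator (fun _ => (1:ℝ)) (x n)) - N * (t₂ - t₁)) ^ 2) =
      ∫ s in (0:ℝ)..1, ∫ t in s..1, (D t - D s) ^ 2 := by
    refine intervalIntegral.integral_congr fun s hs => ?_
    rw [uIcc_of_le zero_le_one] at hs
    refine intervalIntegral.integral_congr fun t ht => ?_
    rw [uIcc_of_le hs.2] at ht
    rw [hDeq s hs, hDeq t ⟨hs.1.trans ht.1, ht.2⟩, discrepancy, discrepancy]
    have : ∀ n, (Ico s t).indicator (fun _ => (1:ℝ)) (x n) =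
        (Ioi (x n)).indicator 1 t - (Ioi (x n)).indicator 1 s := by
      intro n
      by_cases h : x n < s
      · simp [h, h.trans_le ht.1, not_le.2 h]
      · simp [h, indicator_apply, not_lt.1 h]
    simp only [this, Finset.sum_sub_distrib]
    ring
  have hI1 : ∫ t in (0:ℝ)..1, D t = ∫ t in (0:ℝ)..1, discrepancy x t :=
    intervalIntegral.integral_congr fun t ht => hDeq t (by rwa [uIcc_of_le zero_le_one] at ht)
  have hI2 : ∫ t in (0:ℝ)..1, D t ^ 2 = ∫ t in (0:ℝ)..1, discrepancy x t ^ 2 :=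
    intervalIntegral.integral_congr fun t ht => by
      simp only [hDeq t (by rwa [uIcc_of_le zero_le_one] at ht)]
  have hR : ∑ n : Fin N, ∑ m : Fin N, (x n - x m - ((n : ℝ) - (m : ℝ)) / N) ^ 2 =
      ∑ n : Fin N, ∑ m : Fin N, ((x n - (n : ℝ) / N) - (x m - (m : ℝ) / N)) ^ 2 :=
    Finset.sum_congr rfl fun n _ => Finset.sum_congr rfl fun m _ => by ring
  have hsq : ∑ n : Fin N, (x n - (n : ℝ) / N) ^ 2 =
      ∑ n, x n ^ 2 - 2 / N * ∑ n : Fin N, (n : ℝ) * x n + (∑ n : Fin N, (n : ℝ) ^ 2) / N ^ 2 := by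
    rw [Finset.mul_sum, Finset.sum_div, ← Finset.sum_sub_distrib, ← Finset.sum_add_distrib]
    exact Finset.sum_congr rfl fun n _ => by ring
  have hmax : ∑ n : Fin N, (2 * (n : ℝ) + 1) * x n =
      2 * ∑ n : Fin N, (n : ℝ) * x n + ∑ n, x n := by
    rw [Finset.mul_sum, ← Finset.sum_add_distrib]
    exact Finset.sum_congr rfl fun n _ => by ring
  rw [hL, integral_triangle_sub_sq hDm hDC, hI1, hI2, integral_discrepancy hx,
    integral_discrepancy_sq hx, sum_sum_max_of_monotone hmono, hmax, hR, sum_sum_sub_sq, hsq,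
    Finset.sum_sub_distrib, ← Finset.sum_div, sum_fin_val, sum_fin_val_sq]
  field_simp
  ring
end
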